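/- Let d ≥ 1 and suppose that for every ε > 0 there exists C_ε > 0 such that ‖Z(k+1)‖ ≤ C_ε ‖Q(k)‖^ε for all k ≥ 0 (condition (a)), where Q(k) = Z(1)···Z(k) are products of nonnegative integer matrices with all entries ≥ 1 eventually, and λ^{(k)} satisfies λ^{(k)} = Z(k+1)·λ^{(k+1)} componentwise with all λ^{(k)} having positive entries. Then for every ε > 0 there exists C'_ε > 0 such that max_α λ_α^{(k)} ≤ C'_ε · (min_α λ_α^{(k)}) · ‖Q(k)‖^ε for all k. -/

import Mathlib

open Finset

/-- Norm of a real matrix: sum of all its entries. -/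
def matNormSumR {d : ℕ} (A : Matrix (Fin d) (Fin d) ℝ) : ℝ :=
  ∑ i, ∑ j, A i j

/-- The entries of a nonnegative matrix are bounded by the sum of all entries. -/
theorem apply_le_matNormSumR {d : ℕ} {A : Matrix (Fin d) (Fin d) ℝ}
    (hA : ∀ i j, 0 ≤ A i j) (i j : Fin d) : A i j ≤ matNormSumR A :=
  (single_le_sum (fun j _ => hA i j) (mem_univ j)).trans
    (single_le_sum (f := fun i => ∑ j, A i j) (fun i _ => sum_nonneg fun j _ => hA i j)
      (mem_univ i))

theorem matNormSumR_nonneg {d : ℕ} {A : Matrix (Fin d) (Fin d) ℝ}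
    (hA : ∀ i j, 0 ≤ A i j) : 0 ≤ matNormSumR A :=
  sum_nonneg fun i _ => sum_nonneg fun j _ => hA i j

/-- A nonnegative matrix with a positive value in its image has positive entry sum. -/
theorem matNormSumR_pos_of_mulVec_pos {d : ℕ} {A : Matrix (Fin d) (Fin d) ℝ}
    (hA : ∀ i j, 0 ≤ A i j) {v : Fin d → ℝ} {i : Fin d} (h : 0 < A.mulVec v i) :
    0 < matNormSumR A := by
  refine (matNormSumR_nonneg hA).lt_of_ne' fun h0 => h.ne' ?_
  rw [Matrix.mulVec, dotProduct]
  refine sum_eq_zero fun j _ => ?_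
  rw [le_antisymm ((apply_le_matNormSumR hA i j).trans_eq h0) (hA i j), zero_mul]

/-- A matrix with entries at least one maps positive vectors to vectors whose largest and
smallest coordinates differ at most by a factor equal to the entry sum. -/
theorem sup'_mulVec_le_matNormSumR_mul_inf' {d : ℕ} {A : Matrix (Fin d) (Fin d) ℝ}
    (hA : ∀ i j, 1 ≤ A i j) {v : Fin d → ℝ} (hv : ∀ i, 0 < v i)
    (hne : (univ : Finset (Fin d)).Nonempty) :
    univ.sup' hne (A.mulVec v) ≤ matNormSumR A * univ.inf' hne (A.mulVec v) := by
  have hA0 : ∀ i j, 0 ≤ A i j := fun i j => zero_le_one.trans (hA i j)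
  calc univ.sup' hne (A.mulVec v) ≤ matNormSumR A * ∑ j, v j := by
        refine sup'_le _ _ fun i _ => ?_
        rw [mul_sum, Matrix.mulVec, dotProduct]
        exact sum_le_sum fun j _ =>
          mul_le_mul_of_nonneg_right (apply_le_matNormSumR hA0 i j) (hv j).le
    _ ≤ matNormSumR A * univ.inf' hne (A.mulVec v) := by
        refine mul_le_mul_of_nonneg_left ?_ (matNormSumR_nonneg hA0)
        refine le_inf' _ _ fun i _ => ?_
        rw [Matrix.mulVec, dotProduct]
        exact sum_le_sum fun j _ => le_mul_of_one_le_left (hv j).le (hA i j)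

/-- condition (a) (`‖Z(k+1)‖ ≤ C_ε ‖Q(k)‖^ε`) implies the
balance estimate `max λ^{(k)} ≤ C'_ε (min λ^{(k)}) ‖Q(k)‖^ε`, where
`Q k = Z 1 ⬝ ⋯ ⬝ Z k`, the `Z k` are nonnegative with all entries eventually
`≥ 1`, and `λ^{(k)} = Z(k+1) ⬝ λ^{(k+1)}` has positive entries. -/
theorem stmt3 {d : ℕ} (hd : 1 ≤ d)
    (Z Q : ℕ → Matrix (Fin d) (Fin d) ℝ)
    (hQ0 : Q 0 = 1) (hQrec : ∀ k, Q (k + 1) = Q k * Z (k + 1))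
    (hZnonneg : ∀ k i j, 0 ≤ Z k i j)
    (hZpos : ∃ N, ∀ k, N ≤ k → ∀ i j, 1 ≤ Z k i j)
    (lam : ℕ → Fin d → ℝ) (hlampos : ∀ k i, 0 < lam k i)
    (hlam : ∀ k, lam k = (Z (k + 1)).mulVec (lam (k + 1)))
    (hne : (univ : Finset (Fin d)).Nonempty)
    (ha : ∀ ε : ℝ, 0 < ε → ∃ C : ℝ, 0 < C ∧ ∀ k,
      matNormSumR (Z (k + 1)) ≤ C * (matNormSumR (Q k)) ^ ε) :
    ∀ ε : ℝ, 0 < ε → ∃ C' : ℝ, 0 < C' ∧ ∀ k,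
      univ.sup' hne (lam k) ≤
        C' * univ.inf' hne (lam k) * (matNormSumR (Q k)) ^ ε := by
  intro ε hε
  obtain ⟨N, hN⟩ := hZpos
  obtain ⟨C, hC, hCZ⟩ := ha ε hε
  have hQnonneg : ∀ k i j, 0 ≤ Q k i j := by
    intro k
    induction k with
    | zero =>
      intro i j
      rw [hQ0, Matrix.one_apply]
      split_ifs <;> norm_num
    | succ k ih =>
      intro i j
      rw [hQrec, Matrix.mul_apply]
      exact sum_nonneg fun l _ => mul_nonneg (ih i l) (hZnonneg _ l j)
  have hQpos : ∀ k, 0 < matNormSumR (Q k) ^ ε := by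
    intro k
    have hZ : 0 < matNormSumR (Z (k + 1)) := by
      obtain ⟨i, -⟩ := hne
      refine matNormSumR_pos_of_mulVec_pos (hZnonneg _) (v := lam (k + 1)) (i := i) ?_
      rw [← hlam]
      exact hlampos k i
    exact pos_of_mul_pos_right (hZ.trans_le (hCZ k)) hC.le
  have hmin : ∀ k, 0 < univ.inf' hne (lam k) := fun k =>
    (lt_inf'_iff hne).2 fun i _ => hlampos k i
  have hmax : ∀ k, 0 < univ.sup' hne (lam k) := fun k => by
    obtain ⟨i, hi⟩ := id hne
    exact (hlampos k i).trans_le (le_sup' (lam k) hi)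
  set r : ℕ → ℝ := fun k =>
    univ.sup' hne (lam k) / (univ.inf' hne (lam k) * matNormSumR (Q k) ^ ε) with hr
  have hrpos : ∀ k, 0 < r k := fun k => div_pos (hmax k) (mul_pos (hmin k) (hQpos k))
  have hsum : 0 ≤ ∑ k ∈ range N, r k := sum_nonneg fun k _ => (hrpos k).le
  refine ⟨C + ∑ k ∈ range N, r k, by positivity, fun k => ?_⟩
  rw [mul_assoc, ← div_le_iff₀ (mul_pos (hmin k) (hQpos k))]
  change r k ≤ _
  rcases lt_or_ge k N with hk | hk
  · have := single_le_sum (f := r) (fun k _ => (hrpos k).le) (mem_range.2 hk)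
    linarith
  · suffices r k ≤ C by linarith
    rw [hr, div_le_iff₀ (mul_pos (hmin k) (hQpos k))]
    have h := sup'_mulVec_le_matNormSumR_mul_inf' (hN (k + 1) (by omega))
      (hlampos (k + 1)) hne
    rw [← hlam] at h
    calc univ.sup' hne (lam k) ≤ _ := h
      _ ≤ C * matNormSumR (Q k) ^ ε * univ.inf' hne (lam k) :=
        mul_le_mul_of_nonneg_right (hCZ k) (hmin k).le
      _ = C * (univ.inf' hne (lam k) * matNormSumR (Q k) ^ ε) := by ring
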